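/- (Images of the horizontal basis vectors under the differential of the end-to-end map.) Let Q_0,…,Q_N ∈ O(d) with q_{p,i} the i-th column of Q_p, let Λ = diag(λ_1,…,λ_d) with distinct positive entries, and set W_p = Q_p Λ Q_{p−1}ᵀ. Define Φ(𝐕) = ∑_{s=1}^N (W_N⋯W_{s+1}) V_s (W_{s−1}⋯W_1) for 𝐕 = (V_N,…,V_1) ∈ M_d^N. Let l^k ∈ M_d^N have s-th component (1/√N) q_{s,k} q_{s−1,k}ᵀ; let u^{k,l,0} have s-th component √((λ_k² − λ_l²)/(λ_k^{2N} − λ_l^{2N})) λ_k^{s−1} λ_l^{N−s} q_{s,l} q_{s−1,k}ᵀ; and let u^{k,l,N} have s-th component √((λ_k² − λ_l²)/(λ_k^{2N} − λ_l^{2N})) λ_k^{N−s} λ_l^{s−1} q_{s,k} q_{s−1,l}ᵀ (for 1 ≤ k < l ≤ d). Then Φ(l^k) = √N λ_k^{N−1} q_{N,k} q_{0,k}ᵀ, Φ(u^{k,l,N}) = √((λ_k^{2N} − λ_l^{2N})/(λ_k² − λ_l²)) q_{N,k} q_{0,l}ᵀ, and Φ(u^{k,l,0}) = √((λ_k^{2N}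 − λ_l^{2N})/(λ_k² − λ_l²)) q_{N,l} q_{0,k}ᵀ. -/

import Mathlib

open Matrix BigOperators

attribute [local instance] Matrix.normedAddCommGroup Matrix.normedSpace

noncomputable def mpow {d : ℕ} (P : Matrix (Fin d) (Fin d) ℝ) (s : ℝ) :
    Matrix (Fin d) (Fin d) ℝ :=
  if h : P.IsHermitian then
    (h.eigenvectorUnitary : Matrix (Fin d) (Fin d) ℝ) *
      Matrix.diagonal (fun i => (h.eigenvalues i) ^ s) *
      star (h.eigenvectorUnitary : Matrix (Fin d) (Fin d) ℝ)
  else 0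

def Bprod {d : ℕ} (W : ℕ → Matrix (Fin d) (Fin d) ℝ) (p : ℕ) : Matrix (Fin d) (Fin d) ℝ :=
  ((List.range p).map (fun i => W (p - i))).prod

def Aprod {d : ℕ} (W : ℕ → Matrix (Fin d) (Fin d) ℝ) (N p : ℕ) : Matrix (Fin d) (Fin d) ℝ :=
  ((List.range (N + 1 - p)).map (fun i => W (N - i))).prod

def BalancedTuple {d : ℕ} (N : ℕ) (W : ℕ → Matrix (Fin d) (Fin d) ℝ) : Prop :=
  ∀ p, 1 ≤ p → p < N → (W (p+1))ᵀ * W (p+1) = W p * (W p)ᵀ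

noncomputable def frobCLM {d : ℕ} (G : Matrix (Fin d) (Fin d) ℝ) :
    Matrix (Fin d) (Fin d) ℝ →L[ℝ] ℝ :=
  LinearMap.toContinuousLinearMap
    { toFun := fun Z => (Gᵀ * Z).trace
      map_add' := fun x y => by simp [Matrix.mul_add]
      map_smul' := fun c x => by simp [Matrix.mul_smul] }


/-- The tuple `l^k`, with `s`-th component `(1/√N) q_{s,k} q_{s−1,k}ᵀ`. -/
noncomputable def lvec {d : ℕ} (N : ℕ) (Q : ℕ → Matrix (Fin d) (Fin d) ℝ)
    (k : Fin d) (s : ℕ) : Matrix (Fin d) (Fin d) ℝ :=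
  (Real.sqrt N)⁻¹ • Matrix.vecMulVec (fun i => Q s i k) (fun i => Q (s - 1) i k)

/-- The boundary tuple `u^{k,l,0}` of Menon–Yu. -/
noncomputable def uvecZero {d : ℕ} (N : ℕ) (Q : ℕ → Matrix (Fin d) (Fin d) ℝ)
    (lam : Fin d → ℝ) (k l : Fin d) (s : ℕ) : Matrix (Fin d) (Fin d) ℝ :=
  (Real.sqrt ((lam k ^ 2 - lam l ^ 2) / (lam k ^ (2 * N) - lam l ^ (2 * N))) *
      lam k ^ (s - 1) * lam l ^ (N - s)) •
    Matrix.vecMulVec (fun i => Q s i l) (fun i => Q (s - 1) i k)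

/-- The boundary tuple `u^{k,l,N}` of Menon–Yu. -/
noncomputable def uvecN {d : ℕ} (N : ℕ) (Q : ℕ → Matrix (Fin d) (Fin d) ℝ)
    (lam : Fin d → ℝ) (k l : Fin d) (s : ℕ) : Matrix (Fin d) (Fin d) ℝ :=
  (Real.sqrt ((lam k ^ 2 - lam l ^ 2) / (lam k ^ (2 * N) - lam l ^ (2 * N))) *
      lam k ^ (N - s) * lam l ^ (s - 1)) •
    Matrix.vecMulVec (fun i => Q s i k) (fun i => Q (s - 1) i l)

/-- The columns of an orthogonal matrix are mapped by the transpose to the standard basis. -/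
theorem transpose_mulVec_col {d : ℕ} {P : Matrix (Fin d) (Fin d) ℝ} (hP : Pᵀ * P = 1)
    (k : Fin d) : Pᵀ *ᵥ (fun i => P i k) = Pi.single k 1 := by
  have h : (fun i => P i k) = P *ᵥ Pi.single k 1 := by
    rw [Matrix.mulVec_single_one]; rfl
  rw [h, Matrix.mulVec_mulVec, hP, Matrix.one_mulVec]

theorem mul_diagonal_mul_transpose_mulVec_col {d : ℕ} {P R : Matrix (Fin d) (Fin d) ℝ}
    (hP : Pᵀ * P = 1) (lam : Fin d → ℝ) (k : Fin d) :
    (R * Matrix.diagonal lam * Pᵀ) *ᵥ (fun i => P i k) = lam k • fun i => R i k := by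
  rw [← Matrix.mulVec_mulVec, transpose_mulVec_col hP, Matrix.mulVec_single_one]
  ext i
  simp [mul_comm]

theorem col_vecMul_mul_diagonal_mul_transpose {d : ℕ} {P R : Matrix (Fin d) (Fin d) ℝ}
    (hR : Rᵀ * R = 1) (lam : Fin d → ℝ) (k : Fin d) :
    (fun i => R i k) ᵥ* (R * Matrix.diagonal lam * Pᵀ) = lam k • fun i => P i k := by
  rw [← Matrix.mulVec_transpose, Matrix.transpose_mul, Matrix.transpose_mul,
    Matrix.transpose_transpose, Matrix.diagonal_transpose, ← Matrix.mul_assoc,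
    mul_diagonal_mul_transpose_mulVec_col hR]

theorem Bprod_succ {d : ℕ} (W : ℕ → Matrix (Fin d) (Fin d) ℝ) (p : ℕ) :
    Bprod W (p + 1) = W (p + 1) * Bprod W p := by
  simp [Bprod, List.range_succ_eq_map, Function.comp_def]

theorem Aprod_self_succ {d : ℕ} (W : ℕ → Matrix (Fin d) (Fin d) ℝ) (N : ℕ) :
    Aprod W N (N + 1) = 1 := by
  simp [Aprod]

theorem Aprod_eq_mul {d : ℕ} (W : ℕ → Matrix (Fin d) (Fin d) ℝ) {N p : ℕ} (hp : p ≤ N) :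
    Aprod W N p = Aprod W N (p + 1) * W p := by
  have h : N + 1 - p = (N - p) + 1 := by omega
  simp [Aprod, h, List.range_succ, Nat.sub_sub_self hp]

theorem Aprod_mulVec_col {d N : ℕ} {Q : ℕ → Matrix (Fin d) (Fin d) ℝ}
    (hQ : ∀ p ≤ N, (Q p)ᵀ * Q p = 1) (lam : Fin d → ℝ) (k : Fin d) {s : ℕ} (hs : s ≤ N) :
    Aprod (fun q => Q q * Matrix.diagonal lam * (Q (q - 1))ᵀ) N (s + 1) *ᵥ (fun i => Q s i k)
      = lam k ^ (N - s) • fun i => Q N i k := by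
  induction hs using Nat.decreasingInduction with
  | self => simp [Aprod_self_succ]
  | of_succ s hs ih =>
    have h : N - s = (N - (s + 1)) + 1 := by omega
    rw [Aprod_eq_mul (p := s + 1) _ hs, ← Matrix.mulVec_mulVec, Nat.add_sub_cancel,
      mul_diagonal_mul_transpose_mulVec_col (hQ s hs.le), Matrix.mulVec_smul, ih, smul_smul,
      h, pow_succ']

theorem col_vecMul_Bprod {d N : ℕ} {Q : ℕ → Matrix (Fin d) (Fin d) ℝ}
    (hQ : ∀ p ≤ N, (Q p)ᵀ * Q p = 1) (lam : Fin d → ℝ) (k : Fin d) {s : ℕ} (hs : s ≤ N) :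
    (fun i => Q s i k) ᵥ* Bprod (fun q => Q q * Matrix.diagonal lam * (Q (q - 1))ᵀ) s
      = lam k ^ s • fun i => Q 0 i k := by
  induction s with
  | zero => simp [Bprod]
  | succ s ih =>
    rw [Bprod_succ, ← Matrix.vecMul_vecMul, Nat.add_sub_cancel,
      col_vecMul_mul_diagonal_mul_transpose (hQ _ hs), Matrix.smul_vecMul, ih (by omega),
      smul_smul, pow_succ']

/-- The differential of the end-to-end map on a tuple of multiples of `q_{s,k} q_{s-1,l}ᵀ`. -/
theorem sum_Aprod_mul_smul_vecMulVec_mul_Bprod {d N : ℕ} {Q : ℕ → Matrix (Fin d) (Fin d) ℝ}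
    (hQ : ∀ p ≤ N, (Q p)ᵀ * Q p = 1) (lam : Fin d → ℝ) (k l : Fin d) (c : ℕ → ℝ) :
    ∑ s ∈ Finset.Icc 1 N,
        Aprod (fun q => Q q * Matrix.diagonal lam * (Q (q - 1))ᵀ) N (s + 1) *
          (c s • Matrix.vecMulVec (fun i => Q s i k) (fun i => Q (s - 1) i l)) *
          Bprod (fun q => Q q * Matrix.diagonal lam * (Q (q - 1))ᵀ) (s - 1)
      = (∑ s ∈ Finset.Icc 1 N, c s * lam k ^ (N - s) * lam l ^ (s - 1)) •
          Matrix.vecMulVec (fun i => Q N i k) (fun i => Q 0 i l) := by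
  rw [Finset.sum_smul]
  refine Finset.sum_congr rfl fun s hs => ?_
  have hsN := (Finset.mem_Icc.1 hs).2
  rw [Matrix.mul_smul, Matrix.smul_mul, Matrix.mul_vecMulVec, Matrix.vecMulVec_mul,
    Aprod_mulVec_col hQ lam k hsN, col_vecMul_Bprod hQ lam l (by omega),
    Matrix.smul_vecMulVec, Matrix.vecMulVec_smul, smul_smul, smul_smul, mul_assoc]

theorem sum_Icc_sq_pow_mul_sq_pow {x y : ℝ} (h : x ^ 2 ≠ y ^ 2) (N : ℕ) :
    ∑ s ∈ Finset.Icc 1 N, (x ^ (N - s)) ^ 2 * (y ^ (s - 1)) ^ 2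
      = (x ^ (2 * N) - y ^ (2 * N)) / (x ^ 2 - y ^ 2) := by
  rw [pow_mul, pow_mul, ← neg_sub ((y ^ 2) ^ N), ← neg_sub (y ^ 2), neg_div_neg_eq,
    ← (Commute.all _ _).geom_sum₂ h.symm, ← Finset.Ico_add_one_right_eq_Icc,
    Finset.sum_Ico_eq_sum_range, Nat.add_sub_cancel]
  refine Finset.sum_congr rfl fun i _ => ?_
  rw [Nat.add_sub_cancel_left, ← Nat.sub_sub, pow_right_comm x, pow_right_comm y, mul_comm]

theorem sqrt_div_mul_sum_eq_sqrt {x y : ℝ} (h : x ^ 2 ≠ y ^ 2) (N : ℕ) :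
    √((x ^ 2 - y ^ 2) / (x ^ (2 * N) - y ^ (2 * N))) *
        ∑ s ∈ Finset.Icc 1 N, (x ^ (N - s)) ^ 2 * (y ^ (s - 1)) ^ 2
      = √((x ^ (2 * N) - y ^ (2 * N)) / (x ^ 2 - y ^ 2)) := by
  rw [sum_Icc_sq_pow_mul_sq_pow h, ← inv_div, Real.sqrt_inv, inv_mul_eq_div, Real.div_sqrt]

/-- **images of the horizontal basis under `dφ`.**
With `W_p = Q_p Λ Q_{p−1}ᵀ` and `Φ(𝐕) = ∑_s (W_N⋯W_{s+1}) V_s (W_{s−1}⋯W_1)`: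
`Φ(l^k) = √N λ_k^{N−1} q_{N,k} q_{0,k}ᵀ`,
`Φ(u^{k,l,N}) = √((λ_k^{2N}−λ_l^{2N})/(λ_k²−λ_l²)) q_{N,k} q_{0,l}ᵀ`, and
`Φ(u^{k,l,0}) = √((λ_k^{2N}−λ_l^{2N})/(λ_k²−λ_l²)) q_{N,l} q_{0,k}ᵀ`. -/
theorem dln_horizontal_images {d N : ℕ} (hN : 1 ≤ N)
    (Q : ℕ → Matrix (Fin d) (Fin d) ℝ) (hQ : ∀ p ≤ N, (Q p)ᵀ * Q p = 1)
    (lam : Fin d → ℝ) (hpos : ∀ i, 0 < lam i) (hinj : Function.Injective lam) :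
    (∀ k : Fin d,
      ∑ s ∈ Finset.Icc 1 N,
          Aprod (fun q => Q q * Matrix.diagonal lam * (Q (q - 1))ᵀ) N (s + 1) *
            lvec N Q k s *
            Bprod (fun q => Q q * Matrix.diagonal lam * (Q (q - 1))ᵀ) (s - 1)
        = (Real.sqrt N * lam k ^ (N - 1)) •
            Matrix.vecMulVec (fun i => Q N i k) (fun i => Q 0 i k))
    ∧ (∀ k l : Fin d, k < l →
        (∑ s ∈ Finset.Icc 1 N,
            Aprod (fun q => Q q * Matrix.diagonal lam * (Q (q - 1))ᵀ) N (s + 1) *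
              uvecN N Q lam k l s *
              Bprod (fun q => Q q * Matrix.diagonal lam * (Q (q - 1))ᵀ) (s - 1)
          = Real.sqrt ((lam k ^ (2 * N) - lam l ^ (2 * N)) / (lam k ^ 2 - lam l ^ 2)) •
              Matrix.vecMulVec (fun i => Q N i k) (fun i => Q 0 i l))
        ∧ (∑ s ∈ Finset.Icc 1 N,
            Aprod (fun q => Q q * Matrix.diagonal lam * (Q (q - 1))ᵀ) N (s + 1) *
              uvecZero N Q lam k l s *
              Bprod (fun q => Q q * Matrix.diagonal lam * (Q (q - 1))ᵀ) (s - 1)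
          = Real.sqrt ((lam k ^ (2 * N) - lam l ^ (2 * N)) / (lam k ^ 2 - lam l ^ 2)) •
              Matrix.vecMulVec (fun i => Q N i l) (fun i => Q 0 i k))) := by
  have hsq {k l : Fin d} (hkl : k ≠ l) : lam k ^ 2 ≠ lam l ^ 2 := fun h =>
    hkl (hinj ((pow_left_inj₀ (hpos k).le (hpos l).le two_ne_zero).1 h))
  refine ⟨fun k => ?_, fun k l hkl => ⟨?_, ?_⟩⟩
  · simp only [lvec]
    rw [sum_Aprod_mul_smul_vecMulVec_mul_Bprod hQ lam k k fun _ => (√N)⁻¹]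
    congr 1
    have h : ∀ s ∈ Finset.Icc 1 N,
        (√N)⁻¹ * lam k ^ (N - s) * lam k ^ (s - 1) = (√N)⁻¹ * lam k ^ (N - 1) := by
      intro s hs
      rw [Finset.mem_Icc] at hs
      rw [mul_assoc, ← pow_add]
      congr 2
      omega
    rw [Finset.sum_congr rfl h, Finset.sum_const, Nat.card_Icc, Nat.add_sub_cancel,
      nsmul_eq_mul, ← mul_assoc, ← div_eq_mul_inv, Real.div_sqrt]
  · simp only [uvecN]
    rw [sum_Aprod_mul_smul_vecMulVec_mul_Bprod hQ lam k l fun s => _ * _ * _,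
      ← sqrt_div_mul_sum_eq_sqrt (hsq hkl.ne), Finset.mul_sum]
    congr 1
    exact Finset.sum_congr rfl fun s _ => by ring
  · simp only [uvecZero]
    rw [sum_Aprod_mul_smul_vecMulVec_mul_Bprod hQ lam l k fun s => _ * _ * _,
      ← neg_sub (lam l ^ 2), ← neg_sub (lam l ^ (2 * N)), neg_div_neg_eq, neg_div_neg_eq,
      ← sqrt_div_mul_sum_eq_sqrt (hsq hkl.ne'), Finset.mul_sum]
    congr 1
    exact Finset.sum_congr rfl fun s _ => by ring
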